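/- For all integers k ≥ 2 and n ≥ 2k−1, B_0(k, n) + B_1(k, n) + B_0(k−1, n−1) + B_1(k−1, n−1) = B_0(k−1, n−2k+1) + B_1(k−1, n−2k+1) + 2·p_{de}(n−k) + p_{do}(n−2k+1), where B_0 and B_1 are taken to vanish when their second argument is less than their first. -/

import Mathlib

/-!
Definitions following Andrews–El Bachraoui / Chen–Chen–Zhao:
partitions with repeated smallest part.
-/

/-- The smallest part of `π` occurs exactly `k` times and all remaining parts
occur exactly once (are distinct). -/
def IsSptD (k : ℕ) {n : ℕ} (π : n.Partition) : Prop :=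
  ∃ s ∈ π.parts, (∀ x ∈ π.parts, s ≤ x) ∧ Multiset.count s π.parts = k ∧
    ∀ x ∈ π.parts, x ≠ s → Multiset.count x π.parts = 1

/-- `spt k_d(n)`: the number of partitions of `n` whose smallest part occurs
exactly `k` times and whose remaining parts are distinct. -/
noncomputable def sptd (k n : ℕ) : ℕ :=
  Nat.card {π : n.Partition // IsSptD k π}

/-- The smallest part `s` of `π` occurs exactly `k` times, and all remaining parts
occur exactly once and are incongruent to `s` modulo 2. -/
def IsSptDO (k : ℕ) {n : ℕ} (π : n.Partition) : Prop :=
  ∃ s ∈ π.parts, (∀ x ∈ π.parts, s ≤ x) ∧ Multiset.count s π.parts = k ∧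
    ∀ x ∈ π.parts, x ≠ s → Multiset.count x π.parts = 1 ∧ ¬ x % 2 = s % 2

/-- `spt k_{do}(n)`. -/
noncomputable def sptdo (k n : ℕ) : ℕ :=
  Nat.card {π : n.Partition // IsSptDO k π}

/-- As `IsSptDO`, with in addition an even number of parts strictly greater
than the smallest part. -/
def IsSptDOEven (k : ℕ) {n : ℕ} (π : n.Partition) : Prop :=
  ∃ s ∈ π.parts, (∀ x ∈ π.parts, s ≤ x) ∧ Multiset.count s π.parts = k ∧
    (∀ x ∈ π.parts, x ≠ s → Multiset.count x π.parts = 1 ∧ ¬ x % 2 = s % 2) ∧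
    Even (Multiset.card (π.parts.filter fun x => s < x))

/-- As `IsSptDO`, with in addition an odd number of parts strictly greater
than the smallest part. -/
def IsSptDOOdd (k : ℕ) {n : ℕ} (π : n.Partition) : Prop :=
  ∃ s ∈ π.parts, (∀ x ∈ π.parts, s ≤ x) ∧ Multiset.count s π.parts = k ∧
    (∀ x ∈ π.parts, x ≠ s → Multiset.count x π.parts = 1 ∧ ¬ x % 2 = s % 2) ∧
    Odd (Multiset.card (π.parts.filter fun x => s < x))

/-- `B₀(k,n)`. -/
noncomputable def B0 (k n : ℕ) : ℕ :=
  Nat.card {π : n.Partition // IsSptDOEven k π}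

/-- `B₁(k,n)`. -/
noncomputable def B1 (k n : ℕ) : ℕ :=
  Nat.card {π : n.Partition // IsSptDOOdd k π}

/-- `spt k'_{do}(n) = B₀(k,n) - B₁(k,n)`. -/
noncomputable def sptdo' (k n : ℕ) : ℤ :=
  (B0 k n : ℤ) - (B1 k n : ℤ)

/-- `p_d(n)`: number of partitions of `n` into distinct parts. -/
noncomputable def pd (n : ℕ) : ℕ :=
  Nat.card {π : n.Partition // π.parts.Nodup}

/-- `p_{de}(n)`: number of partitions of `n` into distinct even parts. -/
noncomputable def pde (n : ℕ) : ℕ :=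
  Nat.card {π : n.Partition // π.parts.Nodup ∧ ∀ x ∈ π.parts, Even x}

/-- `p_{do}(n)`: number of partitions of `n` into distinct odd parts. -/
noncomputable def pdo (n : ℕ) : ℕ :=
  Nat.card {π : n.Partition // π.parts.Nodup ∧ ∀ x ∈ π.parts, Odd x}

/-- `p'_{do}(n)`: partitions of `n` into an even number of distinct odd parts
minus those into an odd number of distinct odd parts. -/
noncomputable def pdo' (n : ℕ) : ℤ :=
  (Nat.card {π : n.Partition //
      π.parts.Nodup ∧ (∀ x ∈ π.parts, Odd x) ∧ Even (Multiset.card π.parts)} : ℤ) -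
  (Nat.card {π : n.Partition //
      π.parts.Nodup ∧ (∀ x ∈ π.parts, Odd x) ∧ Odd (Multiset.card π.parts)} : ℤ)

theorem sum_val_eq_sum (A : Finset ℕ) : A.val.sum = ∑ x ∈ A, x := by
  rw [Finset.sum, Multiset.map_id']

/-- Finite sets `A` of integers at least `s` and congruent to `s` modulo 2, with `a + ∑ A = n`. -/
def paritySets (s a n : ℕ) : Set (Finset ℕ) :=
  {A | a + ∑ x ∈ A, x = n ∧ ∀ x ∈ A, s ≤ x ∧ x % 2 = s % 2}

theorem paritySets_finite (s a n : ℕ) : (paritySets s a n).Finite := by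
  refine ((Finset.range (n + 1)).powerset.finite_toSet).subset ?_
  rintro A ⟨hA, -⟩
  simp only [Finset.coe_powerset, Set.mem_preimage, Set.mem_powerset_iff, Finset.coe_subset]
  intro x hx
  have := Finset.single_le_sum (f := fun x : ℕ => x) (fun _ _ => Nat.zero_le _) hx
  simp only [Finset.mem_range]
  omega

theorem paritySets_add (s a n b : ℕ) : paritySets s (a + b) (n + b) = paritySets s a n := by
  ext A
  simp only [paritySets, Set.mem_ofPred_eq]
  refine and_congr_left fun _ => ?_
  omega

/-- Split according to whether `s` belongs to the set. -/
theorem ncard_paritySets (s a n : ℕ) :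
    (paritySets s a n).ncard =
      (paritySets (s + 2) a n).ncard + (paritySets (s + 2) (a + s) n).ncard := by
  have notMem : ∀ {b : ℕ} {A : Finset ℕ}, A ∈ paritySets (s + 2) b n → s ∉ A := by
    intro b A hA hs
    have := (hA.2 s hs).1
    omega
  have split : paritySets s a n =
      paritySets (s + 2) a n ∪ insert s '' paritySets (s + 2) (a + s) n := by
    ext A
    constructor
    · rintro ⟨hsum, hA⟩
      by_cases hs : s ∈ A
      · refine Or.inr ⟨A.erase s, ⟨?_, fun x hx => ?_⟩, Finset.insert_erase hs⟩
        · have := Finset.add_sum_erase A (fun x => x) hs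
          omega
        · have := hA x (Finset.mem_of_mem_erase hx)
          have := Finset.ne_of_mem_erase hx
          omega
      · refine Or.inl ⟨hsum, fun x hx => ?_⟩
        have := hA x hx
        have : x ≠ s := fun h => hs (h ▸ hx)
        omega
    · rintro (⟨hsum, hA⟩ | ⟨A, hA, rfl⟩)
      · refine ⟨hsum, fun x hx => ?_⟩
        have := hA x hx
        omega
      · refine ⟨?_, fun x hx => ?_⟩
        · rw [Finset.sum_insert (notMem hA), ← hA.1]
          omega
        · rcases Finset.mem_insert.1 hx with rfl | hx
          · simp
          · have := hA.2 x hx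
            omega
  have disj : Disjoint (paritySets (s + 2) a n) (insert s '' paritySets (s + 2) (a + s) n) := by
    rw [Set.disjoint_left]
    rintro _ hA ⟨A, -, rfl⟩
    exact notMem hA (Finset.mem_insert_self s A)
  rw [split, Set.ncard_union_eq disj (paritySets_finite _ _ _)
    ((paritySets_finite _ _ _).image _), Set.InjOn.ncard_image]
  intro A hA B hB hAB
  rw [← Finset.erase_insert (notMem hA), ← Finset.erase_insert (notMem hB), hAB]

theorem card_nodup_parity (t n : ℕ) (ht : 0 < t) :
    Nat.card {π : n.Partition // π.parts.Nodup ∧ ∀ x ∈ π.parts, t ≤ x ∧ x % 2 = t % 2} =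
      (paritySets t 0 n).ncard := by
  rw [← Nat.card_coe_set_eq]
  refine Nat.card_congr ⟨fun π => ⟨⟨π.1.parts, π.2.1⟩, ?_, π.2.2⟩,
    fun A => ⟨⟨A.1.val, fun hx => ht.trans_le (A.2.2 _ hx).1, ?_⟩, A.1.nodup, A.2.2⟩,
    fun π => rfl, fun A => rfl⟩
  · rw [zero_add, ← sum_val_eq_sum]
    exact π.1.parts_sum
  · rw [sum_val_eq_sum, ← zero_add (∑ x ∈ A.1, x), A.2.1]

theorem pde_eq_ncard (n : ℕ) : pde n = (paritySets 2 0 n).ncard := by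
  rw [← card_nodup_parity 2 n two_pos]
  refine Nat.card_congr (Equiv.subtypeEquivRight fun π => and_congr_right fun _ =>
    forall₂_congr fun x hx => ?_)
  have := π.parts_pos hx
  rw [Nat.even_iff]
  omega

theorem pdo_eq_ncard (n : ℕ) : pdo n = (paritySets 1 0 n).ncard := by
  rw [← card_nodup_parity 1 n one_pos]
  refine Nat.card_congr (Equiv.subtypeEquivRight fun π => and_congr_right fun _ =>
    forall₂_congr fun x hx => ?_)
  have := π.parts_pos hx
  rw [Nat.odd_iff]
  omega

theorem B0_add_B1 (k n : ℕ) : B0 k n + B1 k n = sptdo k n := by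
  have split : {π : n.Partition | IsSptDO k π} =
      {π : n.Partition | IsSptDOEven k π} ∪ {π : n.Partition | IsSptDOOdd k π} := by
    ext π
    constructor
    · rintro ⟨s, hs, hmin, hk, h⟩
      rcases Nat.even_or_odd (Multiset.card (π.parts.filter fun x => s < x)) with he | ho
      · exact Or.inl ⟨s, hs, hmin, hk, h, he⟩
      · exact Or.inr ⟨s, hs, hmin, hk, h, ho⟩
    · rintro (⟨s, hs, hmin, hk, h, -⟩ | ⟨s, hs, hmin, hk, h, -⟩) <;> exact ⟨s, hs, hmin, hk, h⟩
  have disj : Disjoint {π : n.Partition | IsSptDOEven k π} {π | IsSptDOOdd k π} := by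
    rw [Set.disjoint_left]
    rintro π ⟨s, hs, hmin, -, -, he⟩ ⟨t, ht, hmin', -, -, ho⟩
    obtain rfl : s = t := le_antisymm (hmin t ht) (hmin' s hs)
    exact Nat.not_even_iff_odd.2 ho he
  have := Set.ncard_union_eq disj (Set.toFinite _) (Set.toFinite _)
  rw [← split] at this
  exact this.symm

/-- The partition with part `s` repeated `k` times and further parts `A`. -/
def repeatedPartPartition {k n s : ℕ} (hs : 0 < s) (A : paritySets (s + 1) (k * s) n) :
    n.Partition where
  parts := Multiset.replicate k s + A.1.val
  parts_pos {x} hx := by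
    rcases Multiset.mem_add.1 hx with hx | hx
    · exact Multiset.eq_of_mem_replicate hx ▸ hs
    · exact (Nat.succ_pos s).trans_le (A.2.2 x hx).1
  parts_sum := by
    rw [Multiset.sum_add, Multiset.sum_replicate, smul_eq_mul, sum_val_eq_sum, A.2.1]

theorem isSptDO_repeatedPartPartition {k n s : ℕ} (hk : 0 < k) (hs : 0 < s)
    (A : paritySets (s + 1) (k * s) n) : IsSptDO k (repeatedPartPartition hs A) := by
  have hA := A.2.2
  have notMem : s ∉ A.1.val := fun h => by
    have := (hA s h).1
    omega
  refine ⟨s, Multiset.mem_add.2 (Or.inl (Multiset.mem_replicate.2 ⟨hk.ne', rfl⟩)),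
    fun x hx => ?_, ?_, fun x hx hxs => ?_⟩
  · rcases Multiset.mem_add.1 hx with hx | hx
    · exact (Multiset.eq_of_mem_replicate hx).ge
    · have := (hA x hx).1
      omega
  · simp [repeatedPartPartition, Multiset.count_eq_zero_of_notMem notMem]
  · rcases Multiset.mem_add.1 hx with hx | hx
    · exact absurd (Multiset.eq_of_mem_replicate hx) hxs
    · refine ⟨?_, ?_⟩
      · simp [repeatedPartPartition, Multiset.count_replicate, hxs.symm,
          Multiset.count_eq_one_of_mem A.1.nodup hx]
      · have := (hA x hx).2
        omega

/-- Classify by the smallest part `s + 1`; any `M ≥ n` bounds the smallest parts. -/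
theorem sptdo_eq_sum (k n M : ℕ) (hk : 0 < k) (hM : n ≤ M) :
    sptdo k n = ∑ s ∈ Finset.range M, (paritySets (s + 2) (k * (s + 1)) n).ncard := by
  have (s a : ℕ) : Finite (paritySets s a n) := paritySets_finite s a n
  rw [Finset.sum_range]
  simp_rw [← Nat.card_coe_set_eq]
  rw [← Nat.card_sigma]
  symm
  refine Nat.card_congr (Equiv.ofBijective
    (fun p : (s : Fin M) × paritySets (s + 2) (k * (s + 1)) n =>
      (⟨repeatedPartPartition (Nat.succ_pos p.1) p.2,
        isSptDO_repeatedPartPartition hk (Nat.succ_pos p.1) p.2⟩ :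
        {π : n.Partition // IsSptDO k π})) ⟨?_, ?_⟩)
  · rintro ⟨s, A⟩ ⟨t, B⟩ h
    replace h : Multiset.replicate k (s.1 + 1) + A.1.val =
        Multiset.replicate k (t.1 + 1) + B.1.val :=
      congrArg (fun π : {π : n.Partition // IsSptDO k π} => π.1.parts) h
    have le : ∀ {u v : ℕ} {C D : Finset ℕ}, (∀ x ∈ D, v + 2 ≤ x ∧ x % 2 = (v + 2) % 2) →
        Multiset.replicate k (u + 1) + C.val = Multiset.replicate k (v + 1) + D.val →
        v ≤ u := by
      intro u v C D hD h
      have hu : u + 1 ∈ Multiset.replicate k (v + 1) + D.val :=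
        h ▸ Multiset.mem_add.2 (Or.inl (Multiset.mem_replicate.2 ⟨hk.ne', rfl⟩))
      rcases Multiset.mem_add.1 hu with hu | hu
      · have := Multiset.eq_of_mem_replicate hu
        omega
      · have := (hD _ hu).1
        omega
    obtain rfl : s = t := Fin.ext (le_antisymm (le A.2.2 h.symm) (le B.2.2 h))
    obtain rfl : A = B := Subtype.ext (Finset.val_injective (add_left_cancel h))
    rfl
  · rintro ⟨π, s, hs, hmin, hcount, h⟩
    have hpos := π.parts_pos hs
    have hle : s ≤ n := π.parts_sum ▸ Multiset.le_sum_of_mem hs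
    obtain ⟨s, rfl⟩ := Nat.exists_eq_succ_of_ne_zero hpos.ne'
    have hnodup : (π.parts.filter (· ≠ s + 1)).Nodup := by
      rw [Multiset.nodup_iff_count_eq_one]
      intro x hx
      have hx := Multiset.mem_filter.1 hx
      rw [Multiset.count_filter_of_pos (p := fun y => y ≠ s + 1) hx.2]
      exact (h x hx.1 hx.2).1
    have hparts : Multiset.replicate k (s + 1) + π.parts.filter (· ≠ s + 1) = π.parts := by
      rw [← hcount, ← Multiset.filter_eq']
      exact Multiset.filter_add_not _ _
    refine ⟨⟨⟨s, by omega⟩, ⟨⟨π.parts.filter (· ≠ s + 1), hnodup⟩, ?_, fun x hx => ?_⟩⟩,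
      Subtype.ext (Nat.Partition.ext hparts)⟩
    · have := congrArg Multiset.sum hparts
      rw [π.parts_sum, Multiset.sum_add, Multiset.sum_replicate, smul_eq_mul] at this
      rwa [← sum_val_eq_sum]
    · have hx := Multiset.mem_filter.1 hx
      have := hmin x hx.1
      have := (h x hx.1 hx.2).2
      have := hx.2
      dsimp only
      omega

theorem statement18 (k n : ℕ) (hk : 2 ≤ k) (hn : 2 * k - 1 ≤ n) :
    B0 k n + B1 k n + B0 (k - 1) (n - 1) + B1 (k - 1) (n - 1) =
      B0 (k - 1) (n + 1 - 2 * k) + B1 (k - 1) (n + 1 - 2 * k)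
        + 2 * pde (n - k) + pdo (n + 1 - 2 * k) := by
  obtain ⟨j, rfl⟩ : ∃ j, k = j + 1 := ⟨k - 1, by omega⟩
  obtain ⟨r, rfl⟩ : ∃ r, n = r + 2 * j + 1 := ⟨n - (2 * j + 1), by omega⟩
  have h1 : r + 2 * j + 1 + 1 - 2 * (j + 1) = r := by omega
  have h2 : r + 2 * j + 1 - (j + 1) = r + j := by omega
  rw [h1, h2, add_assoc (_ + _), B0_add_B1, B0_add_B1, B0_add_B1]
  simp only [Nat.add_sub_cancel]
  rw [sptdo_eq_sum (j + 1) _ (r + 2 * j + 1 + 2) (by omega) (by omega),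
    sptdo_eq_sum j (r + 2 * j) (r + 2 * j + 1 + 2) (by omega) (by omega),
    sptdo_eq_sum j r (r + 2 * j + 1) (by omega) (by omega), ← Finset.sum_add_distrib]
  have combine (s : ℕ) :
      (paritySets (s + 2) ((j + 1) * (s + 1)) (r + 2 * j + 1)).ncard +
        (paritySets (s + 2) (j * (s + 1)) (r + 2 * j)).ncard =
      (paritySets s (j * (s + 1) + 1) (r + 2 * j + 1)).ncard := by
    rw [ncard_paritySets s, ← paritySets_add (s + 2) (j * (s + 1)) (r + 2 * j) 1, add_comm]
    congr 3
    ring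
  have shift (s : ℕ) : paritySets (s + 1 + 1) (j * (s + 1 + 1 + 1) + 1) (r + 2 * j + 1) =
      paritySets (s + 2) (j * (s + 1)) r := by
    rw [← paritySets_add (s + 2) (j * (s + 1)) r (2 * j + 1)]
    congr 1
    ring
  have head0 : (paritySets 0 (j * (0 + 1) + 1) (r + 2 * j + 1)).ncard = 2 * pde (r + j) := by
    rw [ncard_paritySets, two_mul (pde _), pde_eq_ncard, ← paritySets_add 2 0 (r + j) (j + 1)]
    congr 3 <;> ring
  have head1 : paritySets (0 + 1) (j * (0 + 1 + 1) + 1) (r + 2 * j + 1) = paritySets 1 0 r := by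
    rw [← paritySets_add 1 0 r (2 * j + 1)]
    congr 1
    ring
  simp_rw [combine]
  rw [Finset.sum_range_succ', Finset.sum_range_succ', head0, head1, ← pdo_eq_ncard]
  simp_rw [shift]
  ring
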